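/- arXiv:2011.08471 — 3 statements merged into one kernel-verified Lean document; each statement's English description precedes it below -/
import Mathlib

section
/- Let p > 3 be a prime with p ≡ 2 (mod 3), let s be a positive integer, and let q = p^(2s) (so √q = p^s). If E is an elliptic curve over 𝔽_q with j-invariant 0, then #E(𝔽_q) ∈ {q + 1 + 2p^s, q + 1 − 2p^s, q + 1 + p^s, q + 1 − p^s}. -/
open Finset

/-- A prime congruent to `2` mod `3` is inert for the form `a² + ab + b²`. -/
lemma aux_inert (p : ℕ) (hp : p.Prime) (h3 : p % 3 = 2) (hp3 : 3 < p) (a b : ℤ)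
    (h : (p : ℤ) ∣ a ^ 2 + a * b + b ^ 2) : (p : ℤ) ∣ b := by
  have : Fact p.Prime := ⟨hp⟩
  rw [← ZMod.intCast_zmod_eq_zero_iff_dvd] at h ⊢
  push_cast at h
  by_contra hb
  set A : ZMod p := (a : ZMod p)
  set B : ZMod p := (b : ZMod p)
  have ht : (A / B) ^ 2 + A / B + 1 = 0 := by
    field_simp
    linear_combination h
  set t := A / B
  have ht3 : t ^ 3 = 1 := by linear_combination (t - 1) * ht
  have ht1 : t ≠ 1 := by
    intro h1
    rw [h1] at ht
    have h30 : ((3 : ℕ) : ZMod p) = 0 := by push_cast; linear_combination ht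
    rw [ZMod.natCast_eq_zero_iff] at h30
    have := Nat.le_of_dvd (by norm_num) h30
    omega
  have ho : orderOf t = 3 := by
    have : Fact (Nat.Prime 3) := ⟨Nat.prime_three⟩
    exact orderOf_eq_prime ht3 ht1
  have ht0 : t ≠ 0 := by
    intro h0; rw [h0] at ht3; norm_num at ht3
  have := orderOf_dvd_of_pow_eq_one (ZMod.pow_card_sub_one_eq_one ht0)
  rw [ho] at this
  omega

lemma aux_solve (p : ℕ) (hp : p.Prime) (h3 : p % 3 = 2) (hp3 : 3 < p) (s : ℕ) :
    ∀ a b : ℤ, a ^ 2 + a * b + b ^ 2 = 3 * p ^ (2 * s) →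
      a = p ^ s ∨ a = - p ^ s ∨ a = 2 * p ^ s ∨ a = - (2 * p ^ s) := by
  induction s with
  | zero =>
    intro a b h
    simp only [mul_zero, pow_zero, mul_one] at h ⊢
    have h1 : a ≤ 2 := by nlinarith [sq_nonneg (2 * b + a)]
    have h2 : -2 ≤ a := by nlinarith [sq_nonneg (2 * b + a)]
    have h4 : b ≤ 2 := by nlinarith [sq_nonneg (2 * a + b)]
    have h5 : -2 ≤ b := by nlinarith [sq_nonneg (2 * a + b)]
    interval_cases a <;> interval_cases b <;> simp_all
  | succ s ih =>
    intro a b h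
    have hd : (p : ℤ) ∣ a ^ 2 + a * b + b ^ 2 := by
      rw [h]; exact Dvd.intro (3 * p ^ (2 * s + 1)) (by ring)
    have hb := aux_inert p hp h3 hp3 a b hd
    have ha := aux_inert p hp h3 hp3 b a (by convert hd using 1; ring)
    obtain ⟨a', rfl⟩ := ha
    obtain ⟨b', rfl⟩ := hb
    have hp0 : (p : ℤ) ≠ 0 := by exact_mod_cast hp.ne_zero
    have := ih a' b' (by
      have hp2 : (p : ℤ) ^ 2 ≠ 0 := pow_ne_zero _ hp0
      apply mul_left_cancel₀ hp2
      linear_combination h)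
    rcases this with h | h | h | h <;> rw [h]
    · left; ring
    · right; left; ring
    · right; right; left; ring
    · right; right; right; ring

section
variable {F : Type} [Field F] [Fintype F] [DecidableEq F]

/-- The twisted cubic character sum. -/
def auxU (c : F) : ℤ := ∑ x : F, quadraticChar F (c * x ^ 3 + 1)

lemma auxU_cube (c u : F) (hu : u ≠ 0) : auxU (c * u ^ 3) = auxU c := by
  unfold auxU
  refine Fintype.sum_equiv (Equiv.mulLeft₀ u hu) _ _ ?_
  intro x
  change _ = quadraticChar F (c * (u * x) ^ 3 + 1)
  congr 1; ring

lemma aux_lin (h2 : ringChar F ≠ 2) (d e : F) (hd : d ≠ 0) :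
    ∑ c : F, quadraticChar F (c * d + e) = 0 := by
  rw [← quadraticChar_sum_zero h2]
  refine Fintype.sum_equiv ((Equiv.mulRight₀ d hd).trans (Equiv.addRight e)) _ _ ?_
  intro x; simp

lemma aux_quad0 (h2 : ringChar F ≠ 2) (d : F) (hd : d ≠ 0) :
    ∑ c : F, quadraticChar F (c * (c + d)) = -1 := by
  have key : ∀ c : F, quadraticChar F (c * (c + d)) =
      quadraticChar F (c⁻¹ * d + 1) - if c = 0 then 1 else 0 := by
    intro c
    by_cases hc : c = 0
    · simp [hc]
    · rw [if_neg hc, sub_zero]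
      have : c * (c + d) = c ^ 2 * (c⁻¹ * d + 1) := by field_simp; ring
      rw [this, map_mul, quadraticChar_sq_one' hc, one_mul]
  simp_rw [key, sum_sub_distrib]
  have h1 : ∑ c : F, quadraticChar F (c⁻¹ * d + 1) = 0 := by
    rw [← aux_lin h2 d 1 hd]
    refine Fintype.sum_equiv (Equiv.inv F) _ _ ?_
    intro x; simp
  rw [h1]; simp

lemma aux_quad (h2 : ringChar F ≠ 2) (a b : F) :
    ∑ c : F, quadraticChar F ((c + a) * (c + b)) =
      (if a = b then (Fintype.card F : ℤ) else 0) - 1 := by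
  have h : ∑ c : F, quadraticChar F ((c + a) * (c + b)) =
      ∑ c : F, quadraticChar F (c * (c + (b - a))) := by
    refine Fintype.sum_equiv (Equiv.addRight a) _ _ ?_
    intro x; simp only [Equiv.coe_addRight]; congr 1; ring
  rw [h]
  by_cases hab : a = b
  · subst hab
    have : ∀ c : F, quadraticChar F (c * (c + (a - a))) = 1 - if c = 0 then 1 else 0 := by
      intro c
      by_cases hc : c = 0
      · simp [hc]
      · rw [if_neg hc, sub_self, add_zero, ← sq, quadraticChar_sq_one' hc, sub_zero]
    simp_rw [this, sum_sub_distrib]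
    simp
  · rw [if_neg hab, zero_sub]
    exact aux_quad0 h2 _ (sub_ne_zero.2 (Ne.symm hab))

lemma auxU_sum (h2 : ringChar F ≠ 2) : ∑ c : F, auxU c = Fintype.card F := by
  unfold auxU
  rw [sum_comm, Fintype.sum_eq_single (0 : F)]
  · simp
  · intro x hx
    exact aux_lin h2 _ _ (pow_ne_zero _ hx)

lemma aux_pair (h2 : ringChar F ≠ 2) (x y : F) (hx : x ≠ 0) :
    ∑ c : F, quadraticChar F (c * x ^ 3 + 1) * quadraticChar F (c * y ^ 3 + 1) =
      (if y ^ 3 = x ^ 3 then (Fintype.card F : ℤ) else 0)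
        - quadraticChar F x * quadraticChar F y := by
  by_cases hy : y = 0
  · subst hy
    have : (0 : F) ≠ x ^ 3 := (pow_ne_zero _ hx).symm
    simp [-quadraticChar_apply, quadraticChar_zero, this, aux_lin h2 _ _ (pow_ne_zero 3 hx)]
  · have hk : ∀ c : F, quadraticChar F (c * x ^ 3 + 1) * quadraticChar F (c * y ^ 3 + 1) =
        quadraticChar F x * quadraticChar F y *
          quadraticChar F ((c + (x ^ 3)⁻¹) * (c + (y ^ 3)⁻¹)) := by
      intro c
      have : (c * x ^ 3 + 1) * (c * y ^ 3 + 1) =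
        (x * y) ^ 2 * ((x * y) * ((c + (x ^ 3)⁻¹) * (c + (y ^ 3)⁻¹))) := by
        field_simp
      rw [← map_mul, this, map_mul, quadraticChar_sq_one' (mul_ne_zero hx hy), one_mul,
        map_mul, map_mul _ x y]
    simp_rw [hk, ← mul_sum, aux_quad h2]
    by_cases h : y ^ 3 = x ^ 3
    · have h1 : quadraticChar F x * quadraticChar F y = 1 := by
        rw [← map_mul]
        have hxy : x * y = (y ^ 2 / x) ^ 2 := by
          field_simp
          linear_combination -h
        rw [hxy]
        exact quadraticChar_sq_one' (div_ne_zero (pow_ne_zero _ hy) hx)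
      simp [-quadraticChar_apply, h, h1]
    · have h' : ¬ (x ^ 3)⁻¹ = (y ^ 3)⁻¹ := fun e => h (inv_injective e).symm
      simp [-quadraticChar_apply, h, h']

lemma auxU_sq_sum (h2 : ringChar F ≠ 2) (h3 : #{t : F | t ^ 3 = 1} = 3) :
    ∑ c : F, auxU c ^ 2 =
      (Fintype.card F : ℤ) + 3 * Fintype.card F * (Fintype.card F - 1) := by
  have e1 : ∑ c : F, auxU c ^ 2 = ∑ x : F, ∑ y : F, ∑ c : F,
      quadraticChar F (c * x ^ 3 + 1) * quadraticChar F (c * y ^ 3 + 1) := by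
    simp_rw [sq, auxU, sum_mul_sum]
    rw [sum_comm]
    refine sum_congr rfl fun x _ => ?_
    rw [sum_comm]
  have e2 : ∀ x : F, ∑ y : F, ∑ c : F,
      quadraticChar F (c * x ^ 3 + 1) * quadraticChar F (c * y ^ 3 + 1) =
      3 * (Fintype.card F : ℤ) - if x = 0 then 2 * (Fintype.card F : ℤ) else 0 := by
    intro x
    by_cases hx : x = 0
    · subst hx
      have := auxU_sum (F := F) h2
      simp only [auxU] at this
      rw [sum_comm] at this
      simp [-quadraticChar_apply, this]; ring
    · simp_rw [aux_pair h2 x _ hx, sum_sub_distrib, ← mul_sum, quadraticChar_sum_zero h2]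
      rw [if_neg hx]
      have : ∑ y : F, (if y ^ 3 = x ^ 3 then (Fintype.card F : ℤ) else 0) =
          ∑ t : F, (if t ^ 3 = 1 then (Fintype.card F : ℤ) else 0) := by
        symm
        refine Fintype.sum_equiv (Equiv.mulRight₀ x hx) _ _ ?_
        intro t
        have hx3 := pow_ne_zero 3 hx
        simp [mul_pow, mul_eq_right₀ hx3]
      rw [this, ← sum_filter, sum_const, h3]
      simp
  rw [e1]
  simp_rw [e2, sum_sub_distrib]
  simp
  ring

lemma aux_units (m : ℕ) (hm : Fintype.card F = 3 * m + 1) :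
    ∃ g : F, g ≠ 0 ∧ #{t : F | t ^ 3 = 1} = 3 ∧
      ∀ f : F → ℤ, ∑ c : F, f c = f 0 + ∑ i ∈ range (3 * m), f (g ^ i) := by
  obtain ⟨g, hg⟩ := IsCyclic.exists_generator (α := Fˣ)
  have hcard : Fintype.card Fˣ = 3 * m := by rw [Fintype.card_units]; omega
  have ho : orderOf g = 3 * m := by
    rw [orderOf_eq_card_of_forall_mem_zpowers hg, Nat.card_eq_fintype_card, hcard]
  have hm0 : 0 < m := by
    have := Fintype.one_lt_card (α := F)
    omega
  refine ⟨g, g.ne_zero, ?_, ?_⟩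
  · have hprim : IsPrimitiveRoot (g : F) (3 * m) := by
      rw [IsPrimitiveRoot.coe_units_iff, ← ho]; exact IsPrimitiveRoot.orderOf g
    have hz : IsPrimitiveRoot ((g : F) ^ m) 3 :=
      hprim.pow (by omega) (by ring)
    have := hz.card_nthRootsFinset
    refine Eq.trans ?_ this
    congr 1
    ext t
    simp [Polynomial.mem_nthRootsFinset]
  · intro f
    have h1 : ∑ c : F, f c = f 0 + ∑ u : Fˣ, f u := by
      rw [← Finset.add_sum_erase univ f (mem_univ 0)]
      congr 1
      symm
      refine sum_bij (fun u _ => (u : F)) ?_ ?_ ?_ ?_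
      · intro u _; simp
      · intro u _ v _ h; exact Units.ext h
      · intro b hb; exact ⟨Units.mk0 b (by simpa using hb), mem_univ _, rfl⟩
      · intros; rfl
    rw [h1, ← IsCyclic.image_range_orderOf hg, ho, sum_image]
    · simp
    · intro i hi j hj h
      rw [← ho] at hi hj
      exact pow_injOn_Iio_orderOf (by simpa using hi) (by simpa using hj) h

lemma aux_range3 (f : ℕ → ℤ) (m : ℕ) (hf : ∀ i, f (i + 3) = f i) :
    ∑ i ∈ range (3 * m), f i = m * (f 0 + f 1 + f 2) := by
  have hf' : ∀ k i, f (3 * k + i) = f i := by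
    intro k
    induction k with
    | zero => intro i; simp
    | succ k ih => intro i; rw [← ih i, ← hf (3 * k + i)]; congr 1; ring
  induction m with
  | zero => simp
  | succ m ih =>
    rw [show 3 * (m + 1) = 3 * m + 1 + 1 + 1 by ring, sum_range_succ, sum_range_succ,
      sum_range_succ, ih, add_assoc (3 * m) 1 1, hf', hf']
    have := hf' m 0
    rw [add_zero] at this
    rw [this]; push_cast; ring

lemma auxU_val (p s : ℕ) (hp : p.Prime) (hp3 : 3 < p) (h3 : p % 3 = 2)
    (hF : Fintype.card F = p ^ (2 * s)) (h2 : ringChar F ≠ 2) (c : F) (hc : c ≠ 0) :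
    auxU c = p ^ s ∨ auxU c = - p ^ s ∨ auxU c = 2 * p ^ s ∨ auxU c = - (2 * p ^ s) := by
  have hq : Fintype.card F % 3 = 1 := by
    rw [hF, pow_mul, Nat.pow_mod, Nat.pow_mod p, h3]; norm_num
  obtain ⟨m, hm⟩ : ∃ m, Fintype.card F = 3 * m + 1 := ⟨Fintype.card F / 3, by omega⟩
  have hm0 : (m : ℤ) ≠ 0 := by
    have := Fintype.one_lt_card (α := F)
    have : m ≠ 0 := by omega
    exact_mod_cast this
  obtain ⟨g, hg, hroots, hsum⟩ := aux_units m hm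
  have shift : ∀ f : F → ℤ, (∀ c u, u ≠ 0 → f (c * u ^ 3) = f c) →
      ∑ c : F, f c = f 0 + m * (f c + f (c * g) + f (c * g ^ 2)) := by
    intro f hf
    have : ∑ x : F, f x = ∑ x : F, f (c * x) := by
      symm
      exact Fintype.sum_equiv (Equiv.mulLeft₀ c hc) _ _ (fun x => by simp)
    rw [this, hsum (fun x => f (c * x)), aux_range3 (fun i => f (c * g ^ i)) m]
    · simp
    · intro i
      rw [pow_add, ← mul_assoc, hf _ _ hg]
  have hU0 : auxU (0 : F) = Fintype.card F := by simp [auxU]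
  have s1 := shift auxU auxU_cube
  have s2 := shift (fun c => auxU c ^ 2) (fun c u hu => by simp only [auxU_cube c u hu])
  rw [auxU_sum h2, hU0] at s1
  rw [auxU_sq_sum h2 hroots, hU0] at s2
  set a := auxU c
  set b := auxU (c * g)
  set d := auxU (c * g ^ 2)
  have t1 : a + b + d = 0 := by
    have : (m : ℤ) * (a + b + d) = 0 := by linarith
    exact (mul_eq_zero.1 this).resolve_left hm0
  have hmz : (Fintype.card F : ℤ) = 3 * m + 1 := by exact_mod_cast hm
  have t2 : a ^ 2 + b ^ 2 + d ^ 2 = 6 * Fintype.card F := by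
    apply mul_left_cancel₀ hm0
    rw [hmz] at s2 ⊢
    linear_combination -s2
  have hd : d = - a - b := by linarith
  refine aux_solve p hp h3 hp3 s a b ?_
  rw [hF] at t2
  push_cast at t2
  rw [hd] at t2
  linarith

lemma aux_count (h2 : ringChar F ≠ 2) (E : WeierstrassCurve F) [E.IsElliptic] :
    (Nat.card E.toAffine.Point : ℤ) = Fintype.card F + 1 +
      ∑ x : F, quadraticChar F (4 * x ^ 3 + E.b₂ * x ^ 2 + 2 * E.b₄ * x + E.b₆) := by
  have h20 : (2 : F) ≠ 0 := Ring.two_ne_zero h2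
  have e : E.toAffine.Point ≃ Option (Σ x : F, {z : F // z ^ 2 =
      4 * x ^ 3 + E.b₂ * x ^ 2 + 2 * E.b₄ * x + E.b₆}) :=
    { toFun := fun P => match P with
        | .zero => none
        | .some x y h => some ⟨x, 2 * y + E.a₁ * x + E.a₃, by
            have := (WeierstrassCurve.Affine.equation_iff _ _).1 h.1
            simp only [WeierstrassCurve.b₂, WeierstrassCurve.b₄, WeierstrassCurve.b₆]
            linear_combination 4 * this⟩
      invFun := fun o => match o with
        | none => .zero
        | some ⟨x, z, h⟩ => .some x ((z - E.a₁ * x - E.a₃) / 2) (by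
            rw [← WeierstrassCurve.Affine.equation_iff_nonsingular,
              WeierstrassCurve.Affine.equation_iff]
            simp only [WeierstrassCurve.b₂, WeierstrassCurve.b₄, WeierstrassCurve.b₆] at h
            field_simp
            linear_combination h)
      left_inv := by
        rintro (_ | ⟨x, y, h⟩)
        · rfl
        · simp only [WeierstrassCurve.Affine.Point.some.injEq, true_and]
          field_simp
          ring
      right_inv := by
        rintro (_ | ⟨x, z, h⟩)
        · rfl
        · simp only [Option.some.injEq, Sigma.mk.injEq, heq_eq_eq, true_and, Subtype.mk.injEq]
          field_simp
          ring }
  rw [Nat.card_congr e, Nat.card_eq_fintype_card, Fintype.card_option, Fintype.card_sigma]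
  push_cast
  have : ∀ x : F, (Fintype.card {z : F // z ^ 2 =
      4 * x ^ 3 + E.b₂ * x ^ 2 + 2 * E.b₄ * x + E.b₆} : ℤ) =
      quadraticChar F (4 * x ^ 3 + E.b₂ * x ^ 2 + 2 * E.b₄ * x + E.b₆) + 1 := by
    intro x
    rw [← quadraticChar_card_sqrts h2, Fintype.card_subtype]
    congr 2
    ext z
    simp
  simp_rw [this, sum_add_distrib]
  simp
  ring

end


/-- For `p ≡ 2 (mod 3)`, `q = p^(2s)` an even power of `p`, an elliptic curve over `𝔽_q` with
`j`-invariant `0` has `q + 1 ± 2√q` or `q + 1 ± √q` rational points. -/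
theorem stmt_2 (p s : ℕ) (hp : p.Prime) (hp3 : 3 < p) (hp2mod3 : p % 3 = 2) (hs : 0 < s)
    (F : Type) [Field F] [Fintype F] (hF : Fintype.card F = p ^ (2 * s))
    (E : WeierstrassCurve F) [E.IsElliptic] (hj : E.j = 0) :
    (Nat.card E.toAffine.Point : ℤ) = p ^ (2 * s) + 1 + 2 * p ^ s ∨
    (Nat.card E.toAffine.Point : ℤ) = p ^ (2 * s) + 1 - 2 * p ^ s ∨
    (Nat.card E.toAffine.Point : ℤ) = p ^ (2 * s) + 1 + p ^ s ∨
    (Nat.card E.toAffine.Point : ℤ) = p ^ (2 * s) + 1 - p ^ s := by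
  classical
  have : Fact p.Prime := ⟨hp⟩
  have : CharP F p := by
    obtain ⟨n, hr, hn⟩ := FiniteField.card F (ringChar F)
    have hpr : p = ringChar F := by
      have h1 : p ∣ ringChar F ^ (n : ℕ) := by
        rw [← hn, hF]; exact dvd_pow_self p (by omega)
      exact (Nat.prime_dvd_prime_iff_eq hp hr).1 (hp.dvd_of_dvd_pow h1)
    rw [hpr]; infer_instance
  have hpc : ringChar F = p := ringChar.eq F p
  have h2 : ringChar F ≠ 2 := by omega
  have h20 : (2 : F) ≠ 0 := Ring.two_ne_zero h2
  have h30 : (3 : F) ≠ 0 := by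
    intro h
    have h' : ((3 : ℕ) : F) = 0 := by exact_mod_cast h
    rw [CharP.cast_eq_zero_iff F p] at h'
    have := Nat.le_of_dvd (by norm_num) h'
    omega
  have hc4 : E.c₄ = 0 := by
    rw [WeierstrassCurve.j, Units.mul_right_eq_zero] at hj
    exact pow_eq_zero_iff (three_ne_zero) |>.1 hj
  have hc6 : E.c₆ ≠ 0 := by
    intro h
    have hr := E.c_relation
    rw [hc4, h] at hr
    have hD : E.Δ ≠ 0 := E.isUnit_Δ.ne_zero
    have h1728 : (1728 : F) ≠ 0 := by
      rw [show (1728 : F) = 2 ^ 6 * 3 ^ 3 by norm_num]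
      exact mul_ne_zero (pow_ne_zero _ h20) (pow_ne_zero _ h30)
    apply mul_ne_zero h1728 hD
    rw [hr]; ring
  have h216 : (216 : F) ≠ 0 := by
    rw [show (216 : F) = 2 ^ 3 * 3 ^ 3 by norm_num]
    exact mul_ne_zero (pow_ne_zero _ h20) (pow_ne_zero _ h30)
  have h12 : (12 : F) ≠ 0 := by
    rw [show (12 : F) = 2 ^ 2 * 3 by norm_num]
    exact mul_ne_zero (pow_ne_zero _ h20) h30
  have h40 : (4 : F) ≠ 0 := by
    rw [show (4 : F) = 2 ^ 2 by norm_num]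
    exact pow_ne_zero _ h20
  obtain ⟨w, hw⟩ : ∃ w : F, E.b₂ = 12 * w := ⟨E.b₂ / 12, by field_simp⟩
  have hb4 : E.b₄ = 6 * w ^ 2 := by
    rw [WeierstrassCurve.c₄, hw] at hc4
    have h24 : (24 : F) ≠ 0 := by
      rw [show (24 : F) = 2 * 12 by norm_num]
      exact mul_ne_zero h20 h12
    apply mul_left_cancel₀ h24
    linear_combination -hc4
  obtain ⟨D, hD⟩ : ∃ D : F, D = E.b₆ - 4 * w ^ 3 := ⟨_, rfl⟩
  have hD0 : D ≠ 0 := by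
    intro h
    apply hc6
    rw [WeierstrassCurve.c₆, hw, hb4]
    rw [h] at hD
    linear_combination 216 * hD
  have hsum : ∑ x : F, quadraticChar F (4 * x ^ 3 + E.b₂ * x ^ 2 + 2 * E.b₄ * x + E.b₆) =
      quadraticChar F D * auxU (4 / D) := by
    rw [auxU, mul_sum]
    refine Fintype.sum_equiv (Equiv.addRight w) _ _ ?_
    intro x
    rw [← map_mul]
    congr 1
    simp only [Equiv.coe_addRight]
    rw [hw, hb4]
    field_simp
    rw [hD]
    ring
  have hcount := aux_count h2 E
  rw [hsum, hF] at hcount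
  push_cast at hcount
  have hv := auxU_val p s hp hp3 hp2mod3 hF h2 (4 / D) (div_ne_zero h40 hD0)
  rcases quadraticChar_dichotomy hD0 with hx | hx <;> rw [hx] at hcount <;>
    rcases hv with hv | hv | hv | hv <;> rw [hv] at hcount
  · right; right; left; linarith
  · right; right; right; linarith
  · left; linarith
  · right; left; linarith
  · right; right; right; linarith
  · right; right; left; linarith
  · right; left; linarith
  · left; linarith
end

section
/- (Gauss) Let p > 3 be a prime with p ≡ 1 (mod 3) and let E : y² = x³ + r be an elliptic curve over 𝔽_p with r ≠ 0. Then there exist integers a, b with a² + 3b² = p, b > 0, and a ≡ 2 (mod 3), such that: if r is a sixth power in 𝔽_p^× then #E(𝔽_p) = p + 1 + 2a; if r is a cube but not a square in 𝔽_p^× then #E(𝔽_p) = p + 1 − 2a; if r is a square but not a cube in 𝔽_p^× then #E(𝔽_p) = p + 1 − a + 3b or #E(𝔽_p) = p + 1 − a − 3b; and if r is neither a square nor a cube in 𝔽_p^× then #E(𝔽_p) = p + 1 + a + 3b or #E(𝔽_p) = p + 1 + a − 3b. -/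
open Finset

/-- The character sum attached to `y² = x³ + r`. -/
def gaussS (p : ℕ) [Fact p.Prime] (r : ZMod p) : ℤ :=
  ∑ x : ZMod p, quadraticChar (ZMod p) (x ^ 3 + r)

lemma gauss_ringChar (p : ℕ) [Fact p.Prime] (hp3 : 3 < p) : ringChar (ZMod p) ≠ 2 := by
  rw [ZMod.ringChar_zmod_n]; omega

lemma gauss_card (p : ℕ) [Fact p.Prime] (hp3 : 3 < p) (r : ZMod p) (hr : r ≠ 0) :
    (Nat.card (WeierstrassCurve.toAffine (⟨0, 0, 0, 0, r⟩ : WeierstrassCurve (ZMod p))).Point : ℤ)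
      = p + 1 + gaussS p r := by
  classical
  set E : WeierstrassCurve (ZMod p) := ⟨0, 0, 0, 0, r⟩ with hE
  have h6 : (432 : ZMod p) ≠ 0 := by
    have : ((432 : ℕ) : ZMod p) ≠ 0 := by
      rw [Ne, ZMod.natCast_eq_zero_iff]
      intro h
      have h2 : p ∣ 2 ^ 4 * 3 ^ 3 := by norm_num; exact h
      have hp := Fact.out (p := p.Prime)
      rcases (Nat.Prime.dvd_mul hp).1 h2 with h | h
      · have := Nat.le_of_dvd (by norm_num) (hp.dvd_of_dvd_pow h); omega
      · have := Nat.le_of_dvd (by norm_num) (hp.dvd_of_dvd_pow h); omega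
    exact_mod_cast this
  have hΔ : E.toAffine.Δ ≠ 0 := by
    have : E.toAffine.Δ = -(432 * r ^ 2) := by
      simp [hE, WeierstrassCurve.Δ, WeierstrassCurve.b₂, WeierstrassCurve.b₄,
        WeierstrassCurve.b₆, WeierstrassCurve.b₈]
      ring
    rw [this]
    exact neg_ne_zero.2 (mul_ne_zero h6 (pow_ne_zero _ hr))
  have heq : ∀ x y : ZMod p, E.toAffine.Nonsingular x y ↔ y ^ 2 = x ^ 3 + r := by
    intro x y
    rw [← WeierstrassCurve.Affine.equation_iff_nonsingular_of_Δ_ne_zero hΔ,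
      WeierstrassCurve.Affine.equation_iff]
    simp [hE]
  let e : E.toAffine.Point ≃ Option (Σ x : ZMod p, {y : ZMod p // y ^ 2 = x ^ 3 + r}) :=
    { toFun := fun P => match P with
        | .zero => none
        | .some x y h => some ⟨x, y, (heq x y).1 h⟩
      invFun := fun o => match o with
        | none => .zero
        | some ⟨x, y, h⟩ => .some x y ((heq x y).2 h)
      left_inv := by rintro (_ | _) <;> rfl
      right_inv := by rintro (_ | ⟨_, _, _⟩) <;> rfl }
  rw [Nat.card_congr e, Nat.card_eq_fintype_card, Fintype.card_option, Fintype.card_sigma]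
  push_cast
  have : ∀ x : ZMod p, (Fintype.card {y : ZMod p // y ^ 2 = x ^ 3 + r} : ℤ)
      = quadraticChar (ZMod p) (x ^ 3 + r) + 1 := by
    intro x
    rw [← quadraticChar_card_sqrts (gauss_ringChar p hp3), Fintype.card_subtype]
    congr 2
    ext; simp
  simp only [this, sum_add_distrib, gaussS]
  simp
  ring

lemma gauss_gen (p : ℕ) [Fact p.Prime] (hp1mod3 : p % 3 = 1) (hp3 : 3 < p) :
    ∃ (g : ZMod p) (m : ℕ), g ≠ 0 ∧ p = 3 * m + 1 ∧ 0 < m ∧ g ^ (3 * m) = 1 ∧ g ^ m ≠ 1 ∧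
      (∀ F : ZMod p → ℤ, ∑ x, F x = F 0 + ∑ k ∈ range (3 * m), F (g ^ k)) ∧
      (∀ r : ZMod p, r ≠ 0 → ∃ k, r = g ^ k) := by
  classical
  obtain ⟨g, hg⟩ := IsCyclic.exists_generator (α := (ZMod p)ˣ)
  have hcard : orderOf g = p - 1 := by
    rw [orderOf_eq_card_of_forall_mem_zpowers hg, Nat.card_eq_fintype_card, ZMod.card_units]
  obtain ⟨m, hm⟩ : ∃ m, p = 3 * m + 1 := ⟨p / 3, by omega⟩
  have ho : orderOf g = 3 * m := by omega
  refine ⟨g, m, g.ne_zero, hm, by omega, ?_, ?_, ?_, ?_⟩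
  · rw [← ho, ← Units.val_pow_eq_pow_val, pow_orderOf_eq_one]; rfl
  · intro h
    have : g ^ m = 1 := by ext; simpa using h
    have := Nat.le_of_dvd (by omega) (orderOf_dvd_of_pow_eq_one this)
    omega
  · intro F
    rw [← Finset.add_sum_erase _ _ (mem_univ (0 : ZMod p))]
    congr 1
    symm
    apply Finset.sum_bij (fun k _ => (g : ZMod p) ^ k)
    · intro k _; simp
    · intro a ha b hb h
      simp only [mem_range] at ha hb
      have : g ^ a = g ^ b := by ext; simpa using h
      exact pow_injOn_Iio_orderOf (by simp; omega) (by simp; omega) this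
    · intro b hb
      have hb0 : b ≠ 0 := by simpa using hb
      have h1 := hg (Units.mk0 b hb0)
      have h2 : Units.mk0 b hb0 ∈ Finset.image (fun i => g ^ i) (range (orderOf g)) := by
        rw [IsCyclic.image_range_orderOf hg]; exact mem_univ _
      obtain ⟨k, hk, hk2⟩ := Finset.mem_image.1 h2
      refine ⟨k, by rwa [← ho], ?_⟩
      have := congrArg Units.val hk2
      simpa using this
    · intros; rfl
  · intro r hr
    have h2 : Units.mk0 r hr ∈ Finset.image (fun i => g ^ i) (range (orderOf g)) := by
      rw [IsCyclic.image_range_orderOf hg]; exact mem_univ _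
    obtain ⟨k, hk, hk2⟩ := Finset.mem_image.1 h2
    have := congrArg Units.val hk2
    exact ⟨k, by simpa using this.symm⟩

lemma gauss_quad (p : ℕ) [Fact p.Prime] (hp3 : 3 < p) (u v : ZMod p) :
    ∑ r : ZMod p, quadraticChar (ZMod p) (u + r) * quadraticChar (ZMod p) (v + r)
      = -1 + (if u = v then (p : ℤ) else 0) := by
  classical
  have hF := gauss_ringChar p hp3
  by_cases huv : u = v
  · subst huv
    rw [if_pos rfl]
    rw [Fintype.sum_equiv (Equiv.addLeft u) _
      (fun r => quadraticChar (ZMod p) r * quadraticChar (ZMod p) r) (by intro x; simp)]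
    rw [← Finset.add_sum_erase _ _ (mem_univ (0 : ZMod p))]
    rw [Finset.sum_congr rfl (g := fun _ => (1 : ℤ))]
    · simp
      have : 1 ≤ p := by omega
      push_cast [this]
      ring
    · intro x hx
      rw [← sq]; exact quadraticChar_sq_one (by simpa using hx)
  · rw [if_neg huv, add_zero]
    have hc : v - u ≠ 0 := sub_ne_zero.2 (Ne.symm huv)
    have hj := jacobiSum_nontrivial_inv (quadraticChar_ne_one hF)
    rw [(quadraticChar_isQuadratic (ZMod p)).inv] at hj
    have key : ∑ r : ZMod p, quadraticChar (ZMod p) (u + r) * quadraticChar (ZMod p) (v + r)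
        = quadraticChar (ZMod p) (-1) * jacobiSum (quadraticChar (ZMod p)) (quadraticChar (ZMod p)) := by
      rw [jacobiSum, Finset.mul_sum]
      let e : ZMod p ≃ ZMod p :=
        { toFun := fun s => -(v - u) * s - u
          invFun := fun r => -(r + u) / (v - u)
          left_inv := by intro s; field_simp; ring
          right_inv := by intro s; field_simp; ring }
      symm
      apply Fintype.sum_equiv e
      intro s
      have h1 : u + e s = -1 * ((v - u) * s) := by simp only [e, Equiv.coe_fn_mk]; ring
      have h2 : v + e s = (v - u) * (1 - s) := by simp only [e, Equiv.coe_fn_mk]; ring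
      rw [h1, h2]
      simp only [map_mul]
      have := quadraticChar_sq_one hc
      linear_combination (-(quadraticChar (ZMod p) (-1) * quadraticChar (ZMod p) s * quadraticChar (ZMod p) (1 - s))) * this
    rw [key, hj]
    have := quadraticChar_sq_one (neg_ne_zero.2 (one_ne_zero (α := ZMod p)))
    linear_combination -this

lemma gauss_cube_card (p : ℕ) [Fact p.Prime] (w : ZMod p) (hw : w ^ 3 = 1) (hw1 : w ≠ 1)
    (x : ZMod p) (hx : x ≠ 0) : #{y : ZMod p | x ^ 3 = y ^ 3} = 3 := by
  have h2 : w ^ 2 + w + 1 = 0 := by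
    have : (w - 1) * (w ^ 2 + w + 1) = 0 := by linear_combination hw
    exact (mul_eq_zero.1 this).resolve_left (sub_ne_zero.2 hw1)
  have hw0 : w ≠ 0 := by rintro rfl; simp at hw
  have hww : w ^ 2 ≠ 1 := by
    intro h; apply hw1
    linear_combination hw - w * h
  have hww' : w ^ 2 ≠ w := by
    intro h; apply hw1
    have : w * (w - 1) = 0 := by linear_combination h
    exact sub_eq_zero.1 ((mul_eq_zero.1 this).resolve_left hw0)
  have : ({y : ZMod p | x ^ 3 = y ^ 3} : Finset (ZMod p)) = {x, w * x, w ^ 2 * x} := by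
    ext y
    simp only [mem_filter, mem_univ, true_and, mem_insert, mem_singleton]
    constructor
    · intro h
      have : (y - x) * ((y - w * x) * (y - w ^ 2 * x)) = 0 := by
        linear_combination (-h) + (-x * y ^ 2 + x ^ 2 * y * w) * h2  + (-x ^ 3) * hw
      rcases mul_eq_zero.1 this with h | h
      · left; exact sub_eq_zero.1 h
      · rcases mul_eq_zero.1 h with h | h
        · right; left; exact sub_eq_zero.1 h
        · right; right; exact sub_eq_zero.1 h
    · rintro (rfl | rfl | rfl)
      · rfl
      · rw [mul_pow, hw, one_mul]
      · rw [mul_pow, ← pow_mul, mul_comm 2 3, pow_mul, hw]; simp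
  rw [this, card_eq_three]
  refine ⟨x, w * x, w ^ 2 * x, ?_, ?_, ?_, rfl⟩
  · intro h; exact hw1 (mul_right_cancel₀ hx (by rw [one_mul]; exact h.symm))
  · intro h; exact hww (mul_right_cancel₀ hx (by rw [one_mul]; exact h.symm))
  · intro h; exact hww' (mul_right_cancel₀ hx h.symm)

lemma gauss_periodic (f : ℕ → ℤ) (hf : ∀ k, f (k + 3) = f k) (m : ℕ) :
    ∑ k ∈ range (3 * m), f k = m * (f 0 + f 1 + f 2) := by
  have h : ∀ m, f (3 * m) = f 0 ∧ f (3 * m + 1) = f 1 ∧ f (3 * m + 2) = f 2 := by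
    intro m
    induction m with
    | zero => simp
    | succ n ih =>
      refine ⟨?_, ?_, ?_⟩
      · rw [show 3 * (n + 1) = 3 * n + 3 by ring, hf]; exact ih.1
      · rw [show 3 * (n + 1) + 1 = 3 * n + 1 + 3 by ring, hf]; exact ih.2.1
      · rw [show 3 * (n + 1) + 2 = 3 * n + 2 + 3 by ring, hf]; exact ih.2.2
  induction m with
  | zero => simp
  | succ n ih =>
    rw [show 3 * (n + 1) = 3 * n + 1 + 1 + 1 by ring, sum_range_succ, sum_range_succ,
      sum_range_succ, ih, (h n).1, (h n).2.1, (h n).2.2]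
    push_cast; ring

lemma gauss_twist (p : ℕ) [Fact p.Prime] (r t : ZMod p) (ht : t ≠ 0) :
    gaussS p (r * t ^ 3) = quadraticChar (ZMod p) t * gaussS p r := by
  unfold gaussS
  rw [Finset.mul_sum]
  symm
  apply Fintype.sum_equiv (Equiv.mulLeft₀ t ht)
  intro x
  change _ = quadraticChar (ZMod p) ((t * x) ^ 3 + r * t ^ 3)
  rw [show (t * x) ^ 3 + r * t ^ 3 = t ^ 2 * t * (x ^ 3 + r) by ring, map_mul, map_mul,
    quadraticChar_sq_one' ht, one_mul]

lemma gauss_zero (p : ℕ) [Fact p.Prime] (hp3 : 3 < p) : gaussS p 0 = 0 := by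
  unfold gaussS
  rw [← quadraticChar_sum_zero (gauss_ringChar p hp3)]
  apply Finset.sum_congr rfl
  intro x _
  by_cases hx : x = 0
  · simp [hx]
  · rw [add_zero, pow_succ, map_mul, quadraticChar_sq_one' hx, one_mul]

lemma gauss_mod3 (p : ℕ) [Fact p.Prime] (hp3 : 3 < p) (hp1mod3 : p % 3 = 1) (r : ZMod p) :
    ∃ c, gaussS p r = quadraticChar (ZMod p) r + 3 * c := by
  obtain ⟨g, m, hg0, hm, hm0, hg1, hgm, hsum, hex⟩ := gauss_gen p hp1mod3 hp3
  unfold gaussS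
  rw [hsum, show 3 * m = m + m + m by ring, sum_range_add, sum_range_add]
  refine ⟨∑ k ∈ range m, quadraticChar (ZMod p) ((g ^ k) ^ 3 + r), ?_⟩
  have h1 : ∀ k, (g ^ (m + k)) ^ 3 = (g ^ k) ^ 3 := by
    intro k; rw [pow_add, mul_pow, ← pow_mul, mul_comm m 3, hg1, one_mul]
  have h2 : ∀ k, (g ^ (m + m + k)) ^ 3 = (g ^ k) ^ 3 := by
    intro k; rw [add_assoc, h1, h1]
  simp only [h1, h2]
  simp
  ring

lemma gauss_sum1 (p : ℕ) [Fact p.Prime] (hp3 : 3 < p) :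
    ∑ r : ZMod p, quadraticChar (ZMod p) r * gaussS p r = 0 := by
  unfold gaussS
  simp_rw [Finset.mul_sum]
  rw [Finset.sum_comm]
  have : ∀ x : ZMod p, ∑ r : ZMod p, quadraticChar (ZMod p) r * quadraticChar (ZMod p) (x ^ 3 + r)
      = -1 + (if x = 0 then (p : ℤ) else 0) := by
    intro x
    have := gauss_quad p hp3 0 (x ^ 3)
    simp only [zero_add] at this
    rw [this]
    congr 2
    rw [eq_comm (a := (0 : ZMod p))]
    simp
  simp only [this, sum_add_distrib]
  simp

lemma gauss_sum2 (p : ℕ) [Fact p.Prime] (hp3 : 3 < p) (w : ZMod p) (hw : w ^ 3 = 1)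
    (hw1 : w ≠ 1) : ∑ r : ZMod p, gaussS p r ^ 2 = 2 * p * (p - 1) := by
  unfold gaussS
  simp_rw [sq, Finset.sum_mul_sum]
  rw [Finset.sum_comm]
  have h1 : ∀ x : ZMod p, ∑ r : ZMod p, ∑ y : ZMod p,
      quadraticChar (ZMod p) (x ^ 3 + r) * quadraticChar (ZMod p) (y ^ 3 + r)
      = 2 * p + (if x = 0 then -2 * (p : ℤ) else 0) := by
    intro x
    rw [Finset.sum_comm]
    simp only [gauss_quad p hp3, sum_add_distrib]
    rw [← Finset.sum_filter, Finset.sum_const, Finset.sum_const]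
    by_cases hx : x = 0
    · subst hx
      have : ({y : ZMod p | (0 : ZMod p) ^ 3 = y ^ 3} : Finset (ZMod p)) = {0} := by
        ext y; simp [eq_comm]
      rw [this]; simp
    · rw [gauss_cube_card p w hw hw1 x hx]
      simp [hx]; ring
  simp only [h1, sum_add_distrib]
  simp
  ring

lemma gauss_even (p : ℕ) [Fact p.Prime] (hp3 : 3 < p) (w : ZMod p) (hw : w ^ 3 = 1)
    (hw1 : w ≠ 1) : ∃ c, gaussS p 1 = 2 * c := by
  have h1 : ∀ y : ZMod p, ∃ c, quadraticChar (ZMod p) y = 1 - (if y = 0 then 1 else 0) + 2 * c := by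
    intro y
    by_cases hy : y = 0
    · exact ⟨0, by simp [hy]⟩
    · rcases quadraticChar_dichotomy hy with h | h
      · exact ⟨0, by simp [hy, h]⟩
      · exact ⟨-1, by simp [hy, h]⟩
  choose c hc using h1
  have h3 := gauss_cube_card p w hw hw1 (-1) (by simp)
  have h4 : ∑ x : ZMod p, (if x ^ 3 + 1 = 0 then (1 : ℤ) else 0) = 3 := by
    rw [← Finset.sum_filter, Finset.sum_const]
    rw [Finset.filter_congr (q := fun x => (-1) ^ 3 = x ^ 3), h3]
    · simp
    · intro x _
      constructor
      · intro h; linear_combination -h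
      · intro h; linear_combination -h
  obtain ⟨n, hn⟩ := (Fact.out (p := p.Prime)).odd_of_ne_two (by omega)
  refine ⟨n - 1 + ∑ x : ZMod p, c (x ^ 3 + 1), ?_⟩
  unfold gaussS
  rw [Finset.sum_congr rfl (fun x _ => hc (x ^ 3 + 1)), sum_add_distrib, sum_sub_distrib, h4,
    ← Finset.mul_sum]
  simp
  have : (p : ℤ) = 2 * n + 1 := by exact_mod_cast hn
  rw [this]; ring

/-- Gauss's theorem on the number of points of `y² = x³ + r` over `𝔽_p` for `p ≡ 1 (mod 3)`. -/
theorem stmt_3 (p : ℕ) [Fact p.Prime] (hp3 : 3 < p) (hp1mod3 : p % 3 = 1)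
    (r : ZMod p) (hr : r ≠ 0) :
    ∃ a b : ℤ, a ^ 2 + 3 * b ^ 2 = (p : ℤ) ∧ 0 < b ∧ a ≡ 2 [ZMOD 3] ∧
      (let E : WeierstrassCurve (ZMod p) := ⟨0, 0, 0, 0, r⟩;
        (((∃ t : ZMod p, t ≠ 0 ∧ r = t ^ 6) →
            (Nat.card E.toAffine.Point : ℤ) = (p : ℤ) + 1 + 2 * a) ∧
         (((∃ t : ZMod p, t ≠ 0 ∧ r = t ^ 3) ∧ ¬ (∃ t : ZMod p, t ≠ 0 ∧ r = t ^ 2)) →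
            (Nat.card E.toAffine.Point : ℤ) = (p : ℤ) + 1 - 2 * a) ∧
         (((∃ t : ZMod p, t ≠ 0 ∧ r = t ^ 2) ∧ ¬ (∃ t : ZMod p, t ≠ 0 ∧ r = t ^ 3)) →
            (Nat.card E.toAffine.Point : ℤ) = (p : ℤ) + 1 - a + 3 * b ∨
            (Nat.card E.toAffine.Point : ℤ) = (p : ℤ) + 1 - a - 3 * b) ∧
         ((¬ (∃ t : ZMod p, t ≠ 0 ∧ r = t ^ 2) ∧ ¬ (∃ t : ZMod p, t ≠ 0 ∧ r = t ^ 3)) →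
            (Nat.card E.toAffine.Point : ℤ) = (p : ℤ) + 1 + a + 3 * b ∨
            (Nat.card E.toAffine.Point : ℤ) = (p : ℤ) + 1 + a - 3 * b))) := by
  obtain ⟨g, m, hg0, hm, hm0, hg1, hgm, hsum, hex⟩ := gauss_gen p hp1mod3 hp3
  have hw : (g ^ m) ^ 3 = 1 := by rw [← pow_mul, mul_comm, hg1]
  -- the normalised sums
  obtain ⟨T, hT⟩ : ∃ T : ZMod p → ℤ, ∀ r, T r = quadraticChar (ZMod p) r * gaussS p r :=
    ⟨_, fun _ => rfl⟩
  have hST : ∀ r : ZMod p, r ≠ 0 → gaussS p r = quadraticChar (ZMod p) r * T r := by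
    intro r hr
    have := quadraticChar_sq_one hr
    rw [hT]; linear_combination (-gaussS p r) * this
  have hTtwist : ∀ r t : ZMod p, t ≠ 0 → T (r * t ^ 3) = T r := by
    intro r t ht
    rw [hT, hT, gauss_twist p r t ht, map_mul, map_pow]
    have := quadraticChar_sq_one ht
    linear_combination (quadraticChar (ZMod p) r * gaussS p r * (quadraticChar (ZMod p) t ^ 2 + 1)) * this
  have hper : ∀ k, T (g ^ (k + 3)) = T (g ^ k) := by
    intro k; rw [pow_add, hTtwist _ _ hg0]
  have hmZ : (m : ℤ) ≠ 0 := by exact_mod_cast hm0.ne'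
  have hpm : (p : ℤ) = 3 * m + 1 := by exact_mod_cast hm
  have hs1 : T 1 + T g + T (g ^ 2) = 0 := by
    have h := gauss_sum1 p hp3
    rw [hsum] at h
    simp only [← hT] at h
    rw [gauss_periodic (fun k => T (g ^ k)) hper] at h
    have h0 : T 0 = 0 := by rw [hT, gauss_zero p hp3, mul_zero]
    simp only [h0, zero_add, pow_zero, pow_one] at h
    exact (mul_eq_zero.1 h).resolve_left hmZ
  have hs2 : T 1 ^ 2 + T g ^ 2 + T (g ^ 2) ^ 2 = 6 * p := by
    have h := gauss_sum2 p hp3 (g ^ m) hw hgm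
    rw [hsum, gauss_zero p hp3] at h
    have h' : ∀ k, gaussS p (g ^ k) ^ 2 = T (g ^ k) ^ 2 := by
      intro k
      have := quadraticChar_sq_one (pow_ne_zero k hg0)
      rw [hST _ (pow_ne_zero k hg0), mul_pow, this, one_mul]
    simp only [h'] at h
    rw [gauss_periodic (fun k => T (g ^ k) ^ 2) (fun k => by simp only [hper])] at h
    simp only [pow_zero, pow_one] at h
    apply mul_left_cancel₀ hmZ
    linear_combination h + 2 * (p : ℤ) * hpm
  have hmod : ∀ r : ZMod p, r ≠ 0 → ∃ c, T r = 1 + 3 * c := by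
    intro r hr
    obtain ⟨c, hc⟩ := gauss_mod3 p hp3 hp1mod3 r
    have := quadraticChar_sq_one hr
    refine ⟨quadraticChar (ZMod p) r * c, ?_⟩
    rw [hT, hc]; linear_combination this
  obtain ⟨a, ha⟩ := gauss_even p hp3 (g ^ m) hw hgm
  have hT1 : T 1 = 2 * a := by rw [hT, ha]; simp
  obtain ⟨c0, hc0⟩ := hmod 1 one_ne_zero
  obtain ⟨c1, hc1⟩ := hmod g hg0
  obtain ⟨c2, hc2⟩ := hmod (g ^ 2) (pow_ne_zero _ hg0)
  obtain ⟨d, hd⟩ : ∃ d, T g - T (g ^ 2) = 6 * d := ⟨(c1 - c2) / 2, by omega⟩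
  have hTg : T g = -a + 3 * d := by linarith
  have hTg2 : T (g ^ 2) = -a - 3 * d := by linarith
  have hnorm : a ^ 2 + 3 * d ^ 2 = (p : ℤ) := by
    rw [hT1, hTg, hTg2] at hs2
    linarith
  have hd0 : d ≠ 0 := by
    rintro rfl
    have h1 : a ^ 2 = (p : ℤ) := by linarith
    have hpp : Prime (p : ℤ) := Nat.prime_iff_prime_int.1 Fact.out
    rw [← h1] at hpp
    exact not_prime_pow (by norm_num) hpp
  have hcube : (∃ t : ZMod p, t ≠ 0 ∧ r = t ^ 3) → T r = 2 * a := by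
    rintro ⟨t, ht, rfl⟩
    rw [← one_mul (t ^ 3), hTtwist _ _ ht, hT1]
  have hncube : ¬ (∃ t : ZMod p, t ≠ 0 ∧ r = t ^ 3) → T r = -a + 3 * |d| ∨ T r = -a - 3 * |d| := by
    intro hn
    have key : T r = -a + 3 * d ∨ T r = -a - 3 * d := by
      obtain ⟨k, hk⟩ := hex r hr
      have hk3 : k = 3 * (k / 3) + k % 3 := by omega
      have hk4 : g ^ k = g ^ (k % 3) * (g ^ (k / 3)) ^ 3 := by
        rw [← pow_mul, ← pow_add]; congr 1; omega
      have hTr : T r = T (g ^ (k % 3)) := by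
        rw [hk, hk4, hTtwist _ _ (pow_ne_zero _ hg0)]
      have : k % 3 = 0 ∨ k % 3 = 1 ∨ k % 3 = 2 := by omega
      rcases this with h | h | h
      · exfalso
        apply hn
        refine ⟨g ^ (k / 3), pow_ne_zero _ hg0, ?_⟩
        rw [hk, hk4, h]; simp
      · left; rw [hTr, h, pow_one, hTg]
      · right; rw [hTr, h, hTg2]
    rcases abs_choice d with h | h <;> rw [h]
    · exact key
    · rcases key with h | h
      · right; linarith
      · left; linarith
  have hsq : (∃ t : ZMod p, t ≠ 0 ∧ r = t ^ 2) → gaussS p r = T r := by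
    rintro ⟨t, ht, h⟩
    rw [hST r hr, h, quadraticChar_sq_one' ht, one_mul]
  have hnsq : ¬ (∃ t : ZMod p, t ≠ 0 ∧ r = t ^ 2) → gaussS p r = - T r := by
    intro hn
    have : quadraticChar (ZMod p) r = -1 := by
      rw [quadraticChar_neg_one_iff_not_isSquare]
      rintro ⟨t, ht⟩
      refine hn ⟨t, ?_, by rw [ht]; ring⟩
      rintro rfl
      simp at ht; exact hr ht
    rw [hST r hr, this]; ring
  refine ⟨a, |d|, by rw [sq_abs]; exact hnorm, abs_pos.2 hd0, ?_, ?_⟩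
  · unfold Int.ModEq; omega
  · simp only [gauss_card p hp3 r hr]
    refine ⟨?_, ?_, ?_, ?_⟩
    · rintro ⟨t, ht, h⟩
      have h1 := hsq ⟨t ^ 3, pow_ne_zero _ ht, by rw [h]; ring⟩
      have h2 := hcube ⟨t ^ 2, pow_ne_zero _ ht, by rw [h]; ring⟩
      linarith
    · rintro ⟨h1, h2⟩
      have h1 := hcube h1
      have h2 := hnsq h2
      linarith
    · rintro ⟨h1, h2⟩
      have h1 := hsq h1
      rcases hncube h2 with h | h
      · left; linarith
      · right; linarith
    · rintro ⟨h1, h2⟩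
      have h1 := hnsq h1
      rcases hncube h2 with h | h
      · right; linarith
      · left; linarith
end

section
/- Let p > 3 be a prime with p ≡ 3 (mod 4), let s be a positive integer, and let q = p^(2s) (so √q = p^s). If E is an elliptic curve over 𝔽_q with j-invariant 1728, then #E(𝔽_q) ∈ {q + 1, q + 1 + 2p^s, q + 1 − 2p^s}. -/
open Finset

lemma aux_desc (p : ℕ) (hp : p.Prime) (h3 : p % 4 = 3) (s : ℕ) : ∀ a b : ℤ, a ^ 2 + b ^ 2 = (p : ℤ) ^ (2 * s) →
    a = 0 ∨ a = p ^ s ∨ a = - p ^ s := by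
  have := Fact.mk hp
  induction s with
  | zero =>
    intro a b h
    simp only [mul_zero, pow_zero] at h ⊢
    have h1 : a ≤ 1 := by nlinarith [sq_nonneg b]
    have h2 : -1 ≤ a := by nlinarith [sq_nonneg b]
    omega
  | succ s ih =>
    intro a b h
    have hz : ((a : ZMod p)) ^ 2 = - (b : ZMod p) ^ 2 := by
      have : ((a ^ 2 + b ^ 2 : ℤ) : ZMod p) = 0 := by
        rw [h]; push_cast; simp
      push_cast at this
      linear_combination this
    have hb : (b : ZMod p) = 0 := by
      by_contra hb
      exact ZMod.mod_four_ne_three_of_sq_eq_neg_sq' hb hz h3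
    have ha : (a : ZMod p) = 0 := by
      rw [hb] at hz; simpa using hz
    rw [ZMod.intCast_zmod_eq_zero_iff_dvd] at ha hb
    obtain ⟨a, rfl⟩ := ha
    obtain ⟨b, rfl⟩ := hb
    have hp0 : (p : ℤ) ≠ 0 := by exact_mod_cast hp.ne_zero
    have := ih a b (by
      have : (p : ℤ) ^ 2 * (a ^ 2 + b ^ 2) = p ^ 2 * p ^ (2 * s) := by
        rw [← pow_add]; rw [show 2 + 2 * s = 2 * (s + 1) by ring, ← h]; ring
      exact mul_left_cancel₀ (pow_ne_zero 2 hp0) this)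
    rcases this with h | h | h
    · left; simp [h]
    · right; left; rw [h]; ring
    · right; right; rw [h]; ring

lemma aux_prim : IsPrimitiveRoot (⟨0, 1⟩ : GaussianInt) 4 := by
  rw [IsPrimitiveRoot.iff (by norm_num)]
  refine ⟨by decide, fun l h0 h4 => ?_⟩
  interval_cases l <;> decide

section
variable {F : Type} [Field F] [Fintype F]

lemma star_char (ψ : MulChar F GaussianInt) (h4 : orderOf ψ = 4) (a : F) :
    star (ψ a) = (ψ a) ^ 3 := by
  by_cases ha : a = 0
  · rw [ha, MulChar.map_nonunit ψ not_isUnit_zero]; simp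
  have h : (ψ a) ^ 4 = 1 := by
    rw [← MulChar.pow_apply' _ (by norm_num), ← h4, pow_orderOf_eq_one, MulChar.one_apply (IsUnit.mk0 a ha)]
  have hn : Zsqrtd.norm (ψ a) = 1 := by
    have h1 : (Zsqrtd.norm (ψ a)) ^ 4 = 1 := by
      have := congrArg Zsqrtd.normMonoidHom h
      rw [map_pow, map_one] at this
      exact this
    have h0 : 0 ≤ Zsqrtd.norm (ψ a) := GaussianInt.norm_nonneg _
    exact (pow_eq_one_iff_of_nonneg h0 (by norm_num)).1 h1
  have h2 : ψ a * star (ψ a) = 1 := by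
    rw [← Zsqrtd.norm_eq_mul_conj, hn]; simp
  calc star (ψ a) = (ψ a) ^ 4 * star (ψ a) := by rw [h, one_mul]
    _ = (ψ a) ^ 3 * (ψ a * star (ψ a)) := by ring
    _ = _ := by rw [h2, mul_one]

lemma sq_char [DecidableEq F] (ψ : MulChar F GaussianInt) (h4 : orderOf ψ = 4) (a : F) :
    (ψ a) ^ 2 = (quadraticChar F a : GaussianInt) := by
  by_cases ha : a = 0
  · rw [ha, MulChar.map_nonunit ψ not_isUnit_zero]; simp
  have h : ∀ a : F, a ≠ 0 → (ψ a) ^ 4 = 1 := fun a ha => by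
    rw [← MulChar.pow_apply' _ (by norm_num), ← h4, pow_orderOf_eq_one, MulChar.one_apply (IsUnit.mk0 a ha)]
  have hsq : ∀ a : F, a ≠ 0 → quadraticChar F a = 1 → (ψ a) ^ 2 = 1 := fun a ha hq => by
    rw [quadraticChar_one_iff_isSquare ha] at hq
    obtain ⟨b, rfl⟩ := hq
    have hb : b ≠ 0 := by rintro rfl; simp at ha
    rw [map_mul, ← h b hb]; ring
  have hne : ψ ^ 2 ≠ 1 := by
    intro h
    have := orderOf_dvd_of_pow_eq_one h
    rw [h4] at this
    norm_num at this
  obtain ⟨g, hg⟩ : ∃ g : Fˣ, (ψ g) ^ 2 ≠ 1 := by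
    by_contra! hh
    apply hne
    apply MulChar.ext
    intro g
    rw [MulChar.pow_apply_coe, MulChar.one_apply_coe, hh]
  have hg1 : (ψ g) ^ 2 = -1 := by
    have := h g g.ne_zero
    have h2 : ((ψ g) ^ 2 - 1) * ((ψ g) ^ 2 + 1) = 0 := by linear_combination this
    rcases mul_eq_zero.1 h2 with h3 | h3
    · exact absurd (sub_eq_zero.1 h3) hg
    · exact eq_neg_of_add_eq_zero_left h3
  have hqg : quadraticChar F g = -1 := by
    rcases quadraticChar_dichotomy g.ne_zero with h3 | h3
    · exact absurd (hsq _ g.ne_zero h3) hg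
    · exact h3
  rcases quadraticChar_dichotomy ha with h3 | h3
  · rw [h3, hsq a ha h3]; simp
  · have := hsq (a * g) (mul_ne_zero ha g.ne_zero) (by rw [map_mul, h3, hqg]; norm_num)
    rw [map_mul, mul_pow, hg1] at this
    rw [h3]; push_cast; linear_combination -this

lemma norm_jac (ψ : MulChar F GaussianInt) (h4 : orderOf ψ = 4) :
    Zsqrtd.norm (jacobiSum ψ (ψ ^ 2)) = (Fintype.card F : ℤ) := by
  have hinj : Function.Injective GaussianInt.toComplex := by
    intro x y h; exact GaussianInt.toComplex_inj.1 h
  have hne : ∀ n, 0 < n → n < 4 → (ψ.ringHomComp GaussianInt.toComplex) ^ n ≠ 1 := by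
    intro n hn hn4 h
    rw [MulChar.ringHomComp_pow, MulChar.ringHomComp_eq_one_iff hinj] at h
    have := orderOf_dvd_of_pow_eq_one h
    rw [h4] at this
    have := Nat.le_of_dvd hn this
    omega
  set φ := ψ.ringHomComp GaussianInt.toComplex with hφ
  have key := jacobiSum_mul_jacobiSum_inv (F := F) (F' := ℂ) (χ := φ) (φ := φ ^ 2) (by
      rw [ringChar.eq_zero]; exact (CharP.ringChar_ne_zero_of_finite F).symm)
      (by simpa using hne 1 (by norm_num) (by norm_num)) (hne 2 (by norm_num) (by norm_num))
      (by rw [← pow_succ']; exact hne 3 (by norm_num) (by norm_num))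
  have h1 : jacobiSum φ (φ ^ 2) = GaussianInt.toComplex (jacobiSum ψ (ψ ^ 2)) := by
    rw [hφ, MulChar.ringHomComp_pow, jacobiSum_ringHomComp]
  have h2 : jacobiSum φ⁻¹ (φ ^ 2)⁻¹ = star (jacobiSum φ (φ ^ 2)) := by
    simp only [jacobiSum, star_sum, star_mul', MulChar.star_apply']
  have h3 : (Zsqrtd.norm (jacobiSum ψ (ψ ^ 2)) : ℂ) = (Fintype.card F : ℤ) := by
    rw [h2, h1] at key
    push_cast
    rw [← key, GaussianInt.intCast_complex_norm]
    exact (Complex.mul_conj _).symm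
  exact_mod_cast h3

/-- the twisted sum -/
lemma sum_eval [DecidableEq F] (h2 : ringChar F ≠ 2) (ψ : MulChar F GaussianInt) (h4 : orderOf ψ = 4) (A : F) (hA : A ≠ 0) :
    ∃ T : GaussianInt, Zsqrtd.norm T = (Fintype.card F : ℤ) ∧
      ∑ x : F, quadraticChar F (x ^ 3 + A * x) = 2 * T.re := by
  set T : GaussianInt := ∑ u : F, ψ u * (quadraticChar F (u + A) : GaussianInt) with hT
  have hstar : star T = ∑ u : F, (ψ u) ^ 3 * (quadraticChar F (u + A) : GaussianInt) := by
    rw [hT, star_sum]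
    refine Finset.sum_congr rfl fun u _ => ?_
    rw [star_mul', star_char ψ h4, star_intCast]
  refine ⟨T, ?_, ?_⟩
  · have e : T = ψ (-A) * (ψ A) ^ 2 * jacobiSum ψ (ψ ^ 2) := by
      rw [hT, jacobiSum, Finset.mul_sum]
      rw [← Equiv.sum_comp (Equiv.mulLeft₀ (-A) (neg_ne_zero.2 hA))]
      refine Finset.sum_congr rfl fun v _ => ?_
      rw [← sq_char ψ h4, MulChar.pow_apply' _ (by norm_num)]
      simp only [Equiv.mulLeft₀_apply]
      rw [show -A * v + A = A * (1 - v) by ring, map_mul, map_mul]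
      ring
    have hn : ∀ a : F, a ≠ 0 → Zsqrtd.norm (ψ a) = 1 := by
      intro a ha
      have hu := (IsUnit.mk0 a ha).map ψ
      exact (Zsqrtd.norm_eq_one_iff' (by norm_num) _).2 hu
    rw [e, Zsqrtd.norm_mul, Zsqrtd.norm_mul, sq, Zsqrtd.norm_mul, hn _ hA, hn _ (neg_ne_zero.2 hA), norm_jac ψ h4]
    ring
  · have hS : ((∑ x : F, quadraticChar F (x ^ 3 + A * x) : ℤ) : GaussianInt) = T + star T := by
      push_cast
      have e1 : ∀ x : F, (quadraticChar F (x ^ 3 + A * x) : GaussianInt) =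
          ψ (x ^ 2) * (quadraticChar F (x ^ 2 + A) : GaussianInt) := by
        intro x
        rw [show x ^ 3 + A * x = x * (x ^ 2 + A) by ring, map_mul, Int.cast_mul, ← sq_char ψ h4 x, map_pow]
      simp_rw [e1]
      rw [← Finset.sum_fiberwise (s := Finset.univ) (g := fun x : F => x ^ 2), hstar, hT, ← Finset.sum_add_distrib]
      refine Finset.sum_congr rfl fun u _ => ?_
      have hc := quadraticChar_card_sqrts h2 u
      have : ∑ x with x ^ 2 = u, ψ (x ^ 2) * (quadraticChar F (x ^ 2 + A) : GaussianInt) =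
          ∑ x : F with x ^ 2 = u, ψ u * (quadraticChar F (u + A) : GaussianInt) := by
        refine Finset.sum_congr rfl fun x hx => ?_
        rw [(Finset.mem_filter.1 hx).2]
      rw [this, Finset.sum_const, nsmul_eq_mul]
      have hc' : (((#{x : F | x ^ 2 = u} : ℕ) : ℤ) : GaussianInt) = ψ u ^ 2 + 1 := by
        have hc2 : ((#{x : F | x ^ 2 = u} : ℕ) : ℤ) = quadraticChar F u + 1 := by
          rw [← hc]
          congr 2
          ext; simp
        rw [sq_char ψ h4, hc2]; push_cast; ring
      rw [Int.cast_natCast] at hc'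
      rw [hc']; ring
    have := congrArg Zsqrtd.re hS
    simp only [Zsqrtd.re_intCast, Zsqrtd.re_add, Zsqrtd.re_star] at this
    rw [this]; ring

lemma card_pts [DecidableEq F] (h2 : ringChar F ≠ 2) (h2' : (2 : F) ≠ 0) (h3' : (3 : F) ≠ 0)
    (E : WeierstrassCurve F) [E.IsElliptic] (hj : E.j = 1728) :
    ∃ A : F, A ≠ 0 ∧ (Nat.card E.toAffine.Point : ℤ) = Fintype.card F + 1 +
      ∑ x : F, quadraticChar F (x ^ 3 + A * x) := by
  have hΔ : E.Δ ≠ 0 := E.isUnit_Δ.ne_zero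
  have hc : E.c₄ ^ 3 = 1728 * E.Δ := by
    rw [← hj, WeierstrassCurve.j, mul_right_comm, ← E.coe_Δ', Units.inv_mul, one_mul]
  have h1728 : (1728 : F) ≠ 0 := by
    rw [show (1728 : F) = 2 ^ 6 * 3 ^ 3 by norm_num]
    exact mul_ne_zero (pow_ne_zero _ h2') (pow_ne_zero _ h3')
  have hc6 : E.c₆ = 0 := by
    have := E.c_relation
    have : E.c₆ ^ 2 = 0 := by linear_combination hc + this
    simpa using this
  have hc4 : E.c₄ ≠ 0 := by
    intro h
    rw [h] at hc
    exact mul_ne_zero h1728 hΔ (by rw [← hc]; ring)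
  have h48 : (48 : F) ≠ 0 := by
    rw [show (48 : F) = 2 ^ 4 * 3 by norm_num]
    exact mul_ne_zero (pow_ne_zero _ h2') h3'
  have h12 : (12 : F) ≠ 0 := by
    rw [show (12 : F) = 2 ^ 2 * 3 by norm_num]
    exact mul_ne_zero (pow_ne_zero _ h2') h3'
  refine ⟨-E.c₄ / 48, div_ne_zero (neg_ne_zero.2 hc4) h48, ?_⟩
  set A := -E.c₄ / 48 with hA
  have key : ∀ x y : F, E.toAffine.Equation x y ↔
      (y + (E.a₁ * x + E.a₃) / 2) ^ 2 = (x + E.b₂ / 12) ^ 3 + A * (x + E.b₂ / 12) := by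
    intro x y
    rw [WeierstrassCurve.Affine.equation_iff]
    have hb : ((y + (E.a₁ * x + E.a₃) / 2) ^ 2 - ((x + E.b₂ / 12) ^ 3 + A * (x + E.b₂ / 12)))
       = (y ^ 2 + E.a₁ * x * y + E.a₃ * y) - (x ^ 3 + E.a₂ * x ^ 2 + E.a₄ * x + E.a₆) - E.c₆ / 864 := by
      have h864 : (864 : F) ≠ 0 := by
        rw [show (864 : F) = 2 ^ 5 * 3 ^ 3 by norm_num]
        exact mul_ne_zero (pow_ne_zero _ h2') (pow_ne_zero _ h3')
      have e2 : (2 : F)⁻¹ = 432 * 864⁻¹ := by field_simp; norm_num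
      rw [hA]
      simp only [WeierstrassCurve.c₄, WeierstrassCurve.c₆, WeierstrassCurve.b₂, WeierstrassCurve.b₄, WeierstrassCurve.b₆]
      field_simp
      ring
    rw [hc6, zero_div, sub_zero] at hb
    rw [← sub_eq_zero, ← hb, sub_eq_zero]
  have e1 : E.toAffine.Point ≃ Option {z : F × F // z.2 ^ 2 = z.1 ^ 3 + A * z.1} := {
    toFun := fun P => match P with
      | .zero => none
      | .some x y h => some ⟨(x + E.b₂ / 12, y + (E.a₁ * x + E.a₃) / 2), (key x y).1 h.1⟩
    invFun := fun P => match P with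
      | none => .zero
      | some ⟨(x, y), h⟩ => .some (x - E.b₂ / 12) (y - (E.a₁ * (x - E.b₂ / 12) + E.a₃) / 2)
          (WeierstrassCurve.Affine.equation_iff_nonsingular.1 ((key _ _).2 (by simpa using h)))
    left_inv := by
      rintro (_ | ⟨x, y, h⟩)
      · rfl
      · simp
    right_inv := by
      rintro (_ | ⟨⟨x, y⟩, h⟩)
      · rfl
      · simp }
  rw [Nat.card_congr e1, Nat.card_eq_fintype_card, Fintype.card_option]
  have e2 : {z : F × F // z.2 ^ 2 = z.1 ^ 3 + A * z.1} ≃ Σ x : F, {y : F // y ^ 2 = x ^ 3 + A * x} := {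
    toFun := fun z => ⟨z.1.1, z.1.2, z.2⟩
    invFun := fun z => ⟨(z.1, z.2.1), z.2.2⟩
    left_inv := fun _ => rfl
    right_inv := fun _ => rfl }
  rw [Fintype.card_congr e2, Fintype.card_sigma]
  push_cast
  have e3 : ∀ x : F, (Fintype.card {y : F // y ^ 2 = x ^ 3 + A * x} : ℤ) = quadraticChar F (x ^ 3 + A * x) + 1 := by
    intro x
    rw [← quadraticChar_card_sqrts h2, Set.toFinset_card]
    rfl
  simp_rw [e3]
  rw [Finset.sum_add_distrib]
  simp
  ring
end

/-- For `p ≡ 3 (mod 4)`, `q = p^(2s)` an even power of `p`, an elliptic curve over `𝔽_q` with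
`j`-invariant `1728` has `q + 1` or `q + 1 ± 2√q` rational points. -/
theorem stmt_11 (p s : ℕ) (hp : p.Prime) (hp3 : 3 < p) (hp3mod4 : p % 4 = 3) (hs : 0 < s)
    (F : Type) [Field F] [Fintype F] (hF : Fintype.card F = p ^ (2 * s))
    (E : WeierstrassCurve F) [E.IsElliptic] (hj : E.j = 1728) :
    (Nat.card E.toAffine.Point : ℤ) = p ^ (2 * s) + 1 ∨
    (Nat.card E.toAffine.Point : ℤ) = p ^ (2 * s) + 1 + 2 * p ^ s ∨
    (Nat.card E.toAffine.Point : ℤ) = p ^ (2 * s) + 1 - 2 * p ^ s := by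
  classical
  have hpF : (p : F) = 0 := by
    have : ((Fintype.card F : ℕ) : F) = 0 := FiniteField.cast_card_eq_zero F
    rw [hF] at this
    push_cast at this
    exact pow_eq_zero_iff (by omega) |>.1 this
  have hrc : ringChar F = p := by
    have h1 : ringChar F ∣ p := (ringChar.spec F p).1 hpF
    rcases (Nat.dvd_prime hp).1 h1 with h | h
    · exact absurd h (CharP.ringChar_ne_one)
    · exact h
  have hne : ∀ n : ℕ, 0 < n → n < p → (n : F) ≠ 0 := by
    intro n h0 hn h
    have := (ringChar.spec F n).1 h
    rw [hrc] at this
    exact absurd (Nat.le_of_dvd h0 this) (by omega)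
  have h2 : ringChar F ≠ 2 := by omega
  obtain ⟨A, hA, hcard⟩ := card_pts h2 (by exact_mod_cast hne 2 (by norm_num) (by omega))
    (by exact_mod_cast hne 3 (by norm_num) (by omega)) E hj
  obtain ⟨ψ, hψ⟩ := MulChar.exists_mulChar_orderOf F (n := 4) (by
    rw [hF, pow_mul]
    have h1 : p ^ 2 ≡ 1 [MOD 4] := by
      have : p ≡ 3 [MOD 4] := hp3mod4
      exact (this.pow 2).trans (by decide)
    have h2 := h1.pow s
    rw [one_pow] at h2
    exact (Nat.modEq_iff_dvd' (Nat.one_le_pow _ _ (by positivity))).1 h2.symm) aux_prim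
  obtain ⟨T, hT, hS⟩ := sum_eval h2 ψ hψ A hA
  rw [hF, Zsqrtd.norm_def] at hT
  push_cast at hT
  rw [hcard, hS, hF]
  push_cast
  rcases aux_desc p hp hp3mod4 s T.re T.im (by linear_combination hT) with h | h | h
  · left; rw [h]; ring
  · right; left; rw [h]
  · right; right; rw [h]; ring
end
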